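/- Let α, β ∈ ℂ with |α| = |β| = 1, and suppose βⁿ ≠ 1 for every nonzero integer n. Let T be the operator on holomorphic functions on 𝔸 defined by (Tf)(z) = α·f(β·z). If λ ∈ ℂ satisfies |λ| ≠ 1, then the map f ↦ Tf − λ·f is a bijection from the space of holomorphic functions on 𝔸 onto itself; in particular the spectrum of T is contained in the unit circle. -/

import Mathlib

open Complex Set

/-- The open annulus `{z : 1/R < |z| < R}`, symmetric with respect to the unit circle. -/
def ann (R : ℝ) : Set ℂ := {z : ℂ | 1 / R < ‖z‖ ∧ ‖z‖ < R}

/-- `T − λ·Id` is injective on `Hol(𝔸)`, where `(Tf)(z) = α f(βz)` (functions being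
identified when they agree on the annulus). -/
def TInj (R : ℝ) (α β lam : ℂ) : Prop :=
  ∀ f g : ℂ → ℂ, DifferentiableOn ℂ f (ann R) → DifferentiableOn ℂ g (ann R) →
    (∀ z ∈ ann R, α * f (β * z) - lam * f z = α * g (β * z) - lam * g z) →
    ∀ z ∈ ann R, f z = g z

/-- `T − λ·Id` is surjective on `Hol(𝔸)`, where `(Tf)(z) = α f(βz)`. -/
def TSurj (R : ℝ) (α β lam : ℂ) : Prop :=
  ∀ g : ℂ → ℂ, DifferentiableOn ℂ g (ann R) →
    ∃ f : ℂ → ℂ, DifferentiableOn ℂ f (ann R) ∧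
      ∀ z ∈ ann R, α * f (β * z) - lam * f z = g z

theorem isOpen_ann (R : ℝ) : IsOpen (ann R) :=
  (isOpen_lt continuous_const continuous_norm).inter (isOpen_lt continuous_norm continuous_const)

theorem mul_mem_ann {R : ℝ} {b z : ℂ} (hb : ‖b‖ = 1) (hz : z ∈ ann R) : b * z ∈ ann R := by
  simpa [ann, hb] using hz

theorem exists_mem_ann_of_lt {R : ℝ} (hR : 1 < R) {z : ℂ} (hz : z ∈ ann R) :
    ∃ r, 0 < r ∧ r < R ∧ z ∈ ann r := by
  have hR0 : 0 < R := one_pos.trans hR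
  have hz0 : 0 < ‖z‖ := (one_div_pos.2 hR0).trans hz.1
  obtain ⟨r, h1, h2⟩ := exists_between (max_lt ((one_div_lt hR0 hz0).1 hz.1) hz.2)
  obtain ⟨h3, h4⟩ := max_lt_iff.1 h1
  have hr : 0 < r := hz0.trans h4
  exact ⟨r, hr, h2, (one_div_lt hz0 hr).1 h3, h4⟩

/-- A continuous function on the annulus is bounded on smaller concentric annuli. -/
theorem ContinuousOn.exists_bound_ann {R r : ℝ} (hr : 0 < r) (hrR : r < R) {g : ℂ → ℂ}
    (hg : ContinuousOn g (ann R)) : ∃ M, ∀ z ∈ ann r, ‖g z‖ ≤ M := by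
  have hK : IsCompact {z : ℂ | 1 / r ≤ ‖z‖ ∧ ‖z‖ ≤ r} := by
    refine (isCompact_closedBall (0 : ℂ) r).of_isClosed_subset
      ((isClosed_le continuous_const continuous_norm).inter
        (isClosed_le continuous_norm continuous_const)) fun z hz => ?_
    simpa using hz.2
  obtain ⟨M, hM⟩ := hK.exists_bound_of_continuousOn (hg.mono fun z hz =>
    ⟨(one_div_lt_one_div_of_lt hr hrR).trans_le hz.1, hz.2.trans_lt hrR⟩)
  exact ⟨M, fun z hz => hM z ⟨hz.1.le, hz.2.le⟩⟩

theorem eq_zero_of_eq_mul_comp_rotation {R : ℝ} (hR : 1 < R) {a b : ℂ} (ha : ‖a‖ < 1)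
    (hb : ‖b‖ = 1) {h : ℂ → ℂ} (hc : ContinuousOn h (ann R))
    (heq : ∀ z ∈ ann R, h z = a * h (b * z)) : ∀ z ∈ ann R, h z = 0 := by
  intro z hz
  have hpow (n : ℕ) : ‖b ^ n‖ = 1 := by simp [hb]
  have hiter (n : ℕ) : h z = a ^ n * h (b ^ n * z) := by
    induction n with
    | zero => simp
    | succ n ih =>
      rw [ih, heq _ (mul_mem_ann (hpow n) hz), ← mul_assoc, ← mul_assoc, ← pow_succ, ← pow_succ']
  obtain ⟨r, hr, hrR, hzr⟩ := exists_mem_ann_of_lt hR hz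
  obtain ⟨M, hM⟩ := hc.exists_bound_ann hr hrR
  have hlim : Filter.Tendsto (fun n : ℕ => ‖a‖ ^ n * M) Filter.atTop (nhds 0) := by
    simpa using (tendsto_pow_atTop_nhds_zero_of_lt_one (norm_nonneg a) ha).mul_const M
  have hle : ‖h z‖ ≤ 0 := by
    refine ge_of_tendsto' hlim fun n => ?_
    rw [hiter n, norm_mul, norm_pow]
    exact mul_le_mul_of_nonneg_left (hM _ (mul_mem_ann (hpow n) hzr)) (by positivity)
  exact norm_le_zero_iff.1 hle

/-- The Neumann series `∑ aⁿ g(bⁿ z)` solves `f(z) - a f(bz) = g(z)` on the annulus. -/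
theorem exists_sub_mul_comp_rotation_eq {R : ℝ} (hR : 1 < R) {a b : ℂ} (ha : ‖a‖ < 1)
    (hb : ‖b‖ = 1) {g : ℂ → ℂ} (hg : DifferentiableOn ℂ g (ann R)) :
    ∃ f : ℂ → ℂ, DifferentiableOn ℂ f (ann R) ∧ ∀ z ∈ ann R, f z - a * f (b * z) = g z := by
  have hpow (n : ℕ) : ‖b ^ n‖ = 1 := by simp [hb]
  have hbound {r M : ℝ} (hM : ∀ z ∈ ann r, ‖g z‖ ≤ M) (n : ℕ) (z : ℂ) (hz : z ∈ ann r) :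
      ‖a ^ n * g (b ^ n * z)‖ ≤ ‖a‖ ^ n * M := by
    rw [norm_mul, norm_pow]
    exact mul_le_mul_of_nonneg_left (hM _ (mul_mem_ann (hpow n) hz)) (by positivity)
  have hsum (M : ℝ) : Summable fun n : ℕ => ‖a‖ ^ n * M :=
    (summable_geometric_of_lt_one (norm_nonneg a) ha).mul_right M
  refine ⟨fun z => ∑' n : ℕ, a ^ n * g (b ^ n * z), fun z hz => ?_, fun z hz => ?_⟩
  · obtain ⟨r, hr, hrR, hzr⟩ := exists_mem_ann_of_lt hR hz
    obtain ⟨M, hM⟩ := hg.continuousOn.exists_bound_ann hr hrR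
    have hsub : ann r ⊆ ann R := fun w hw =>
      ⟨(one_div_lt_one_div_of_lt hr hrR).trans hw.1, hw.2.trans hrR⟩
    have hd : DifferentiableOn ℂ (fun z => ∑' n : ℕ, a ^ n * g (b ^ n * z)) (ann r) := by
      refine differentiableOn_tsum_of_summable_norm (hsum M) (fun n => ?_) (isOpen_ann r)
        (hbound hM)
      exact (hg.comp (by fun_prop) fun w hw => mul_mem_ann (hpow n) (hsub hw)).const_mul _
    exact (hd.differentiableAt ((isOpen_ann r).mem_nhds hzr)).differentiableWithinAt
  · obtain ⟨r, hr, hrR, hzr⟩ := exists_mem_ann_of_lt hR hz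
    obtain ⟨M, hM⟩ := hg.continuousOn.exists_bound_ann hr hrR
    have hs : Summable fun n : ℕ => a ^ n * g (b ^ n * z) :=
      .of_norm_bounded (hsum M) fun n => hbound hM n z hzr
    have hshift : a * ∑' n : ℕ, a ^ n * g (b ^ n * (b * z)) =
        ∑' n : ℕ, a ^ (n + 1) * g (b ^ (n + 1) * z) := by
      rw [← tsum_mul_left]
      exact tsum_congr fun n => by rw [pow_succ', pow_succ, mul_assoc, mul_assoc]
    simp only [hshift]
    rw [hs.tsum_eq_zero_add]
    simp

theorem tInj_of_norm_ne_one {R : ℝ} (hR : 1 < R) {α β lam : ℂ} (hα : ‖α‖ = 1) (hβ : ‖β‖ = 1)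
    (hlam : ‖lam‖ ≠ 1) : TInj R α β lam := by
  intro f g hf hg heq z hz
  have hα0 : α ≠ 0 := norm_ne_zero_iff.1 (by simp [hα])
  have hβ0 : β ≠ 0 := norm_ne_zero_iff.1 (by simp [hβ])
  have hc : ContinuousOn (f - g) (ann R) := hf.continuousOn.sub hg.continuousOn
  suffices h : (f - g) z = 0 from sub_eq_zero.1 h
  rcases hlam.lt_or_gt with hlt | hgt
  · refine eq_zero_of_eq_mul_comp_rotation hR (a := lam / α) (b := β⁻¹) (by simpa [hα] using hlt)
      (by simp [hβ]) hc (fun w hw => ?_) z hz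
    have h := heq (β⁻¹ * w) (mul_mem_ann (by simp [hβ]) hw)
    rw [mul_inv_cancel_left₀ hβ0] at h
    simp only [Pi.sub_apply]
    field_simp at h ⊢
    linear_combination h
  · have hlam0 : lam ≠ 0 := norm_pos_iff.1 (one_pos.trans hgt)
    refine eq_zero_of_eq_mul_comp_rotation hR (a := α / lam) (b := β)
      (by simpa [hα] using inv_lt_one_of_one_lt₀ hgt) hβ hc (fun w hw => ?_) z hz
    have h := heq w hw
    simp only [Pi.sub_apply]
    field_simp
    linear_combination -h

theorem tSurj_of_norm_ne_one {R : ℝ} (hR : 1 < R) {α β lam : ℂ} (hα : ‖α‖ = 1) (hβ : ‖β‖ = 1)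
    (hlam : ‖lam‖ ≠ 1) : TSurj R α β lam := by
  intro g hg
  have hα0 : α ≠ 0 := norm_ne_zero_iff.1 (by simp [hα])
  have hβ0 : β ≠ 0 := norm_ne_zero_iff.1 (by simp [hβ])
  rcases hlam.lt_or_gt with hlt | hgt
  · have hg' : DifferentiableOn ℂ (fun w => α⁻¹ * g (β⁻¹ * w)) (ann R) :=
      (hg.comp (by fun_prop) fun w hw => mul_mem_ann (by simp [hβ]) hw).const_mul _
    obtain ⟨f, hf, h⟩ := exists_sub_mul_comp_rotation_eq hR (a := lam / α) (b := β⁻¹)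
      (by simpa [hα] using hlt) (by simp [hβ]) hg'
    refine ⟨f, hf, fun z hz => ?_⟩
    have h := h (β * z) (mul_mem_ann hβ hz)
    rw [inv_mul_cancel_left₀ hβ0] at h
    field_simp at h
    linear_combination h
  · have hlam0 : lam ≠ 0 := norm_pos_iff.1 (one_pos.trans hgt)
    obtain ⟨f, hf, h⟩ := exists_sub_mul_comp_rotation_eq hR (a := α / lam) (b := β)
      (by simpa [hα] using inv_lt_one_of_one_lt₀ hgt) hβ (hg.const_mul (-lam⁻¹))
    refine ⟨f, hf, fun z hz => ?_⟩
    have h := h z hz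
    field_simp at h
    linear_combination -h

/-- Let `(Tf)(z) = α f(βz)` with `|α| = |β| = 1` and `β` aperiodic. If `|λ| ≠ 1` then
`T − λ·Id` is a bijection of `Hol(𝔸)`; in particular the spectrum of `T` is contained in
the unit circle. -/
theorem stmt16 (R : ℝ) (hR : 1 < R) (α β : ℂ)
    (hα : ‖α‖ = 1) (hβ : ‖β‖ = 1)
    (hap : ∀ m : ℤ, m ≠ 0 → β ^ m ≠ 1) :
    (∀ lam : ℂ, ‖lam‖ ≠ 1 → TInj R α β lam ∧ TSurj R α β lam) ∧
    {lam : ℂ | ¬ (TInj R α β lam ∧ TSurj R α β lam)} ⊆ {lam : ℂ | ‖lam‖ = 1} := by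
  have h (lam : ℂ) (hlam : ‖lam‖ ≠ 1) : TInj R α β lam ∧ TSurj R α β lam :=
    ⟨tInj_of_norm_ne_one hR hα hβ hlam, tSurj_of_norm_ne_one hR hα hβ hlam⟩
  exact ⟨h, fun lam hlam => by_contra fun hne => hlam (h lam hne)⟩
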